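/- Let (R, m) be a commutative Noetherian local ring, a an ideal, and M a finitely generated R-module of dimension n with H_a^n(M) ≠ 0. Then there exists a quotient module K of M such that dim K = n, K has no nonzero submodule of dimension less than n, Ass(K) = { p ∈ Ass(M) : cd(a, R/p) = n }, and H_a^n(K) ≅ H_a^n(M). -/

import Mathlib

noncomputable section

universe u

open CategoryTheory

/-- The `i`-th local cohomology of a module with respect to an ideal. -/
abbrev LC {R : Type u} [CommRing R] (J : Ideal R) (i : ℕ) (M : Type u)
    [AddCommGroup M] [Module R M] : ModuleCat.{u} R :=
  (localCohomology J i).obj (ModuleCat.of R M)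

/-- Attached primes of a module: primes of the form `Ann(T/U)`. -/
def Att (R : Type u) [CommRing R] (T : Type u) [AddCommGroup T] [Module R T] :
    Set (Ideal R) :=
  { p | p.IsPrime ∧ ∃ U : Submodule R T, p = Module.annihilator R (T ⧸ U) }

/-- Krull dimension of a module, as the Krull dimension of its support. -/
def mdim (R : Type u) [CommRing R] (M : Type u) [AddCommGroup M] [Module R M] :
    WithBot ℕ∞ :=
  Order.krullDim (Module.support R M)

/-- Cohomological dimension of `M` with respect to `J`:
the supremum of the `i` with `H_J^i(M) ≠ 0` (`⊥` if there are none). -/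
def cohDim (R : Type u) [CommRing R] (J : Ideal R) (M : Type u)
    [AddCommGroup M] [Module R M] : WithBot ℕ∞ :=
  sSup { x | ∃ i : ℕ, x = (i : ℕ∞) ∧ Nontrivial (LC J i M) }

namespace LCaux
open Limits Opposite

variable {R : Type u} [CommRing R]

abbrev Fy (Y : ModuleCat.{u} R) : ModuleCat.{u} R ⥤ (ModuleCat.{u} R)ᵒᵖ :=
  ((linearYoneda R (ModuleCat.{u} R)).obj Y).rightOp

abbrev Kc {X : ModuleCat.{u} R} (P : ProjectiveResolution X) (Y : ModuleCat.{u} R) :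
    ChainComplex (ModuleCat.{u} R)ᵒᵖ ℕ :=
  ((Fy Y).mapHomologicalComplex _).obj P.complex

abbrev ExtObj (n : ℕ) (X Y : ModuleCat.{u} R) : ModuleCat.{u} R :=
  ((Ext R (ModuleCat.{u} R) n).obj (op X)).obj Y

/-- derived functor as homology -/
def isoL {X : ModuleCat.{u} R} (P : ProjectiveResolution X) (n : ℕ) (Y : ModuleCat.{u} R) :
    ((Fy Y).leftDerived n).obj X ≅ (Kc P Y).homology n := P.isoLeftDerivedObj (Fy Y) n

/-- cocycles to Ext -/
def epsM {X : ModuleCat.{u} R} (P : ProjectiveResolution X) (n : ℕ) (Y : ModuleCat.{u} R) :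
    ((Kc P Y).opcycles n).unop ⟶ ExtObj n X Y :=
  ((isoL P n Y).hom ≫ (Kc P Y).homologyι n).unop

/-- cocycles to cochains -/
def incM {X : ModuleCat.{u} R} (P : ProjectiveResolution X) (n : ℕ) (Y : ModuleCat.{u} R) :
    ((Kc P Y).opcycles n).unop ⟶ ModuleCat.of R (P.complex.X n ⟶ Y) :=
  ((Kc P Y).pOpcycles n).unop

variable {X X' : ModuleCat.{u} R} (P : ProjectiveResolution X) (P' : ProjectiveResolution X')
  (n : ℕ) (Y Y' : ModuleCat.{u} R)

lemma incM_inj : Function.Injective (incM P n Y) := by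
  have : Mono (incM P n Y) := unop_mono_of_epi ((Kc P Y).pOpcycles n)
  exact (ModuleCat.mono_iff_injective _).1 this

lemma epsM_surj : Function.Surjective (epsM P n Y) := by
  have : Epi (epsM P n Y) := unop_epi_of_mono ((isoL P n Y).hom ≫ (Kc P Y).homologyι n)
  exact (ModuleCat.epi_iff_surjective _).1 this

lemma incM_cocycle (z) : P.complex.d (n+1) n ≫ (incM P n Y z : P.complex.X n ⟶ Y) = 0 := by
  have h := (Kc P Y).d_pOpcycles (n+1) n
  have h2 := congrArg Quiver.Hom.unop h
  exact congrArg (fun k => (ModuleCat.Hom.hom k) z) h2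

lemma exists_incM (f : P.complex.X n ⟶ Y) (hf : P.complex.d (n+1) n ≫ f = 0) :
    ∃ z, incM P n Y z = f := by
  have hc := (ShortComplex.exact_of_g_is_cokernel (ShortComplex.mk _ _ ((Kc P Y).d_pOpcycles (n+1) n)) ((Kc P Y).opcyclesIsCokernel (n+1) n (by simp))).unop
  rw [ShortComplex.moduleCat_exact_iff] at hc
  exact hc f hf

lemma epsM_zero (z) : epsM P n Y z = 0 ↔ ∃ j, ∃ g : P.complex.X j ⟶ Y,
    incM P n Y z = P.complex.d n j ≫ g := by
  have hc := (ShortComplex.exact_of_f_is_kernel (ShortComplex.mk _ _ ((Kc P Y).homologyι_comp_fromOpcycles n ((ComplexShape.down ℕ).next n))) ((Kc P Y).homologyIsKernel n _ rfl)).unop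
  rw [ShortComplex.moduleCat_exact_iff] at hc
  have hf : ∀ j, ∀ g : P.complex.X j ⟶ Y,
      incM P n Y (((Kc P Y).fromOpcycles n j).unop g) = P.complex.d n j ≫ g := by
    intro j g
    have h := congrArg Quiver.Hom.unop ((Kc P Y).p_fromOpcycles n j)
    exact congrArg (fun k => (ModuleCat.Hom.hom k) g) h
  constructor
  · intro h
    have h' : ((Kc P Y).homologyι n).unop z = 0 := by
      have hi : Mono (isoL P n Y).hom.unop := inferInstance
      apply (ModuleCat.mono_iff_injective _).1 hi
      rw [map_zero]
      exact h
    obtain ⟨g, hg⟩ := hc z h'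
    exact ⟨_, g, (congrArg (incM P n Y) hg.symm).trans (hf _ g)⟩
  · rintro ⟨j, g, h⟩
    rw [← hf] at h
    rw [incM_inj P n Y h]
    have h := congrArg Quiver.Hom.unop ((Kc P Y).homologyι_comp_fromOpcycles n j)
    have h2 := congrArg (fun k => (ModuleCat.Hom.hom k) g) h
    refine Eq.trans (congrArg (isoL P n Y).hom.unop h2) ?_
    exact map_zero _

lemma eps_natY (k : Y ⟶ Y') (z z') (h : incM P n Y' z' = (incM P n Y z : P.complex.X n ⟶ Y) ≫ k) :
    ((Ext R (ModuleCat.{u} R) n).obj (op X)).map k (epsM P n Y z) = epsM P n Y' z' := by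
  let α : Fy Y' ⟶ Fy Y := NatTrans.rightOp ((linearYoneda R (ModuleCat.{u} R)).map k)
  let β := (NatTrans.mapHomologicalComplex α (ComplexShape.down ℕ)).app P.complex
  have h1 : (NatTrans.leftDerived α n).app X ≫ ((isoL P n Y).hom ≫ (Kc P Y).homologyι n)
      = ((isoL P n Y').hom ≫ (Kc P Y').homologyι n) ≫ HomologicalComplex.opcyclesMap β n := by
    have h0 : (NatTrans.leftDerived α n).app X = (isoL P n Y').hom ≫
        HomologicalComplex.homologyMap β n ≫ (isoL P n Y).inv :=
      ProjectiveResolution.leftDerived_app_eq α P n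
    rw [h0]
    simp only [Category.assoc, Iso.inv_hom_id_assoc]
    rw [HomologicalComplex.homologyι_naturality β n]
  have h2 := congrArg (fun k => (ModuleCat.Hom.hom k) z) (congrArg Quiver.Hom.unop h1)
  refine Eq.trans h2 ?_
  have h3 : (HomologicalComplex.opcyclesMap β n).unop z = z' := by
    apply incM_inj
    rw [h]
    exact congrArg (fun k => (ModuleCat.Hom.hom k) z) (congrArg Quiver.Hom.unop (HomologicalComplex.p_opcyclesMap β n))
  rw [← h3]
  rfl

variable {P P'} in
lemma eps_natX (w : X' ⟶ X) (φ : P'.complex ⟶ P.complex) (comm : φ.f 0 ≫ P.π.f 0 = P'.π.f 0 ≫ w)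
    (z z') (h : incM P' n Y z' = φ.f n ≫ (incM P n Y z : P.complex.X n ⟶ Y)) :
    ((Ext R (ModuleCat.{u} R) n).map w.op).app Y (epsM P n Y z) = epsM P' n Y z' := by
  let β := ((Fy Y).mapHomologicalComplex (ComplexShape.down ℕ)).map φ
  have h1 : ((Fy Y).leftDerived n).map w ≫ ((isoL P n Y).hom ≫ (Kc P Y).homologyι n)
      = ((isoL P' n Y).hom ≫ (Kc P' Y).homologyι n) ≫ HomologicalComplex.opcyclesMap β n := by
    have h0 : ((Fy Y).leftDerived n).map w ≫ (isoL P n Y).hom = (isoL P' n Y).hom ≫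
        HomologicalComplex.homologyMap β n :=
      ProjectiveResolution.isoLeftDerivedObj_hom_naturality w P' P φ comm (Fy Y) n
    rw [← Category.assoc, h0, Category.assoc, Category.assoc,
      HomologicalComplex.homologyι_naturality β n]
  have h2 := congrArg (fun k => (ModuleCat.Hom.hom k) z) (congrArg Quiver.Hom.unop h1)
  refine Eq.trans h2 ?_
  have h3 : (HomologicalComplex.opcyclesMap β n).unop z = z' := by
    apply incM_inj
    rw [h]
    exact congrArg (fun k => (ModuleCat.Hom.hom k) z) (congrArg Quiver.Hom.unop (HomologicalComplex.p_opcyclesMap β n))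
  rw [← h3]
  rfl


open localCohomology

variable (a : Ideal R)

abbrev Ht (n : ℕ) (Y : ModuleCat.{u} R) : ModuleCat.{u} R := (localCohomology a n).obj Y

abbrev Xt (t : ℕ) : ModuleCat.{u} R := (ringModIdeals (idealPowersDiagram a)).obj (op t)

/-- chosen resolutions -/
def Pt (t : ℕ) : ProjectiveResolution (Xt a t) := projectiveResolution _

abbrev Ct (t : ℕ) : ChainComplex (ModuleCat.{u} R) ℕ := (Pt a t).complex

abbrev wt {t s : ℕ} (h : t ≤ s) : Xt a s ⟶ Xt a t :=
  (ringModIdeals (idealPowersDiagram a)).map (homOfLE h).op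

/-- transition -/
def ph {t s : ℕ} (h : t ≤ s) : Ct a s ⟶ Ct a t :=
  ProjectiveResolution.lift (wt a h) (Pt a s) (Pt a t)

lemma ph_comm {t s : ℕ} (h : t ≤ s) : (ph a h).f 0 ≫ (Pt a t).π.f 0 = (Pt a s).π.f 0 ≫ wt a h :=
  ProjectiveResolution.lift_commutes_zero _ _ _

/-- into the colimit -/
def inM (t n : ℕ) (Y : ModuleCat.{u} R) : ExtObj n (Xt a t) Y ⟶ Ht a n Y :=
  (colimit.ι (diagram (idealPowersDiagram a) n) (op (op t))).app Y

/-- The cocone -/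
def coc (n : ℕ) (Y : ModuleCat.{u} R) : Cocone (diagram (idealPowersDiagram a) n ⋙ (evaluation _ _).obj Y) :=
  ((evaluation _ _).obj Y).mapCocone (colimit.cocone (diagram (idealPowersDiagram a) n))

def cocIs (n : ℕ) (Y : ModuleCat.{u} R) : IsColimit (coc a n Y) :=
  isColimitOfPreserves _ (colimit.isColimit _)

lemma inM_nat (t n : ℕ) {Y Y' : ModuleCat.{u} R} (k : Y ⟶ Y') (e) :
    (localCohomology a n).map k (inM a t n Y e) =
      inM a t n Y' (((Ext R (ModuleCat.{u} R) n).obj (op (Xt a t))).map k e) := by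
  have h := (colimit.ι (diagram (idealPowersDiagram a) n) (op (op t))).naturality k
  exact (congrArg (fun k => (ModuleCat.Hom.hom k) e) h).symm

lemma inM_tr {t s : ℕ} (h : t ≤ s) (n : ℕ) (Y : ModuleCat.{u} R) (e) :
    inM a s n Y (((Ext R (ModuleCat.{u} R) n).map (wt a h).op).app Y e) = inM a t n Y e := by
  have h := (coc a n Y).w (homOfLE h).op.op
  exact (congrArg (fun k => (ModuleCat.Hom.hom k) e) h)

instance presInst (n : ℕ) (Y : ModuleCat.{u} R) :
    PreservesColimit (diagram (idealPowersDiagram a) n ⋙ (evaluation (ModuleCat.{u} R) (ModuleCat.{u} R)).obj Y)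
    (forget (ModuleCat.{u} R)) := by
  have : PreservesFilteredColimitsOfSize.{0, 0} (forget (ModuleCat.{u} R)) :=
    preservesFilteredColimitsOfSize_shrink.{0, u, 0, u} _
  have := this.preserves_filtered_colimits (ℕᵒᵖᵒᵖ)
  infer_instance

lemma inM_surj (n : ℕ) (Y : ModuleCat.{u} R) (e : Ht a n Y) : ∃ t e', inM a t n Y e' = e := by
  obtain ⟨j, y, h⟩ := Concrete.isColimit_exists_rep _ (cocIs a n Y) e
  exact ⟨j.unop.unop, y, h⟩

lemma inM_zero (t n : ℕ) (Y : ModuleCat.{u} R) (e) (h : inM a t n Y e = 0) :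
    ∃ s, ∃ h : t ≤ s, ((Ext R (ModuleCat.{u} R) n).map (wt a h).op).app Y e = 0 := by
  have h' : (coc a n Y).ι.app (op (op t)) e = (coc a n Y).ι.app (op (op t)) 0 := by
    rw [map_zero]; exact h
  obtain ⟨k, f, g, hk⟩ := Concrete.isColimit_exists_of_rep_eq _ (cocIs a n Y) e 0 h'
  refine ⟨k.unop.unop, leOfHom f.unop.unop, ?_⟩
  rw [map_zero] at hk
  exact hk

/-- class of a cocycle -/
def cls {t n : ℕ} {Y : ModuleCat.{u} R} (f : (Ct a t).X n ⟶ Y) (hf : (Ct a t).d (n+1) n ≫ f = 0) :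
    Ht a n Y :=
  inM a t n Y (epsM (Pt a t) n Y (exists_incM (Pt a t) n Y f hf).choose)

section
variable {a} {t n : ℕ} {Y : ModuleCat.{u} R}

lemma cls_eq (f : (Ct a t).X n ⟶ Y) (hf : (Ct a t).d (n+1) n ≫ f = 0) (z)
    (h : incM (Pt a t) n Y z = f) : cls a f hf = inM a t n Y (epsM (Pt a t) n Y z) := by
  unfold cls
  congr 2
  apply incM_inj
  rw [h, (exists_incM (Pt a t) n Y f hf).choose_spec]

lemma cls_sub (f g : (Ct a t).X n ⟶ Y) (hf) (hg) (hfg) :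
    cls a (f - g) hfg = cls a f hf - cls a g hg := by
  obtain ⟨z, rfl⟩ := exists_incM (Pt a t) n Y f hf
  obtain ⟨y, rfl⟩ := exists_incM (Pt a t) n Y g hg
  rw [cls_eq _ hf z rfl, cls_eq _ hg y rfl, cls_eq _ hfg (z - y) (map_sub _ _ _), map_sub, map_sub]

lemma cls_smul (r : R) (f : (Ct a t).X n ⟶ Y) (hf) (hfg) :
    cls a (r • f) hfg = r • cls a f hf := by
  obtain ⟨z, rfl⟩ := exists_incM (Pt a t) n Y f hf
  rw [cls_eq _ hf z rfl, cls_eq _ hfg (r • z) (map_smul _ _ _), map_smul, map_smul]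

lemma cls_surj (e : Ht a n Y) : ∃ (t : ℕ) (f : (Ct a t).X n ⟶ Y) (hf : _), cls a f hf = e := by
  obtain ⟨t, e, rfl⟩ := inM_surj a n Y e
  obtain ⟨z, rfl⟩ := epsM_surj (Pt a t) n Y e
  exact ⟨t, incM (Pt a t) n Y z, incM_cocycle _ _ _ _, cls_eq _ _ z rfl⟩

lemma cls_map {Y' : ModuleCat.{u} R} (k : Y ⟶ Y') (f : (Ct a t).X n ⟶ Y) (hf) (hfk) :
    (localCohomology a n).map k (cls a f hf) = cls a (f ≫ k) hfk := by
  obtain ⟨z, hz⟩ := exists_incM (Pt a t) n Y f hf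
  obtain ⟨z', hz'⟩ := exists_incM (Pt a t) n Y' (f ≫ k) hfk
  rw [cls_eq _ hf z hz, cls_eq _ hfk z' hz', inM_nat, eps_natY _ _ _ _ _ z z' (by rw [hz, hz'])]

lemma cls_tr {s : ℕ} (h : t ≤ s) (f : (Ct a t).X n ⟶ Y) (hf) (hfk) :
    cls a ((ph a h).f n ≫ f) hfk = cls a f hf := by
  obtain ⟨z, hz⟩ := exists_incM (Pt a t) n Y f hf
  obtain ⟨z', hz'⟩ := exists_incM (Pt a s) n Y _ hfk
  rw [cls_eq _ hf z hz, cls_eq _ hfk z' hz', ← inM_tr a h,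
    eps_natX _ _ _ (ph a h) (ph_comm a h) z z' (by rw [hz, hz'])]

lemma cls_zero_of (f : (Ct a t).X n ⟶ Y) (hf) (j : ℕ) (g : (Ct a t).X j ⟶ Y)
    (h : f = (Ct a t).d n j ≫ g) : cls a f hf = 0 := by
  obtain ⟨z, hz⟩ := exists_incM (Pt a t) n Y f hf
  rw [cls_eq _ hf z hz, (epsM_zero (Pt a t) n Y z).2 ⟨j, g, by rw [hz, h]⟩, map_zero]

lemma cls_zero (f : (Ct a t).X n ⟶ Y) (hf) (h : cls a f hf = 0) :
    ∃ s, ∃ h : t ≤ s, ∃ j, ∃ g : (Ct a s).X j ⟶ Y, (ph a h).f n ≫ f = (Ct a s).d n j ≫ g := by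
  obtain ⟨z, hz⟩ := exists_incM (Pt a t) n Y f hf
  rw [cls_eq _ hf z hz] at h
  obtain ⟨s, hs, h⟩ := inM_zero a _ _ _ _ h
  obtain ⟨z', hz'⟩ := exists_incM (Pt a s) n Y ((ph a hs).f n ≫ f) (by
    rw [← HomologicalComplex.Hom.comm_assoc, hf, comp_zero])
  rw [eps_natX _ _ _ (ph a hs) (ph_comm a hs) z z' (by rw [hz, hz']), epsM_zero] at h
  obtain ⟨j, g, h⟩ := h
  exact ⟨s, hs, j, g, by rw [← h, hz']⟩

lemma ph_coc {s : ℕ} (h : t ≤ s) (f : (Ct a t).X n ⟶ Y) (hf : (Ct a t).d (n+1) n ≫ f = 0) :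
    (Ct a s).d (n+1) n ≫ (ph a h).f n ≫ f = 0 := by
  rw [← HomologicalComplex.Hom.comm_assoc, hf, comp_zero]
end


instance projCt (t n : ℕ) : Projective ((Ct a t).X n) := (Pt a t).projective n

section LES
variable {a} {n : ℕ} {S : ShortComplex (ModuleCat.{u} R)} (hS : S.ShortExact)
include hS

/-- lifting along the epimorphism -/
lemma ex_lift {Q : ModuleCat.{u} R} [Projective Q] (f : Q ⟶ S.X₃) : ∃ g : Q ⟶ S.X₂, g ≫ S.g = f := by
  have := hS.epi_g
  exact ⟨Projective.factorThru f S.g, Projective.factorThru_comp _ _⟩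

lemma ex_fac {Q : ModuleCat.{u} R} (f : Q ⟶ S.X₂) (h : f ≫ S.g = 0) : ∃ g : Q ⟶ S.X₁, g ≫ S.f = f := by
  have := hS.mono_f
  exact ⟨hS.exact.lift f h, hS.exact.lift_f f h⟩

lemma les2 (e : Ht a n S.X₂) (he : (localCohomology a n).map S.g e = 0) :
    ∃ e', (localCohomology a n).map S.f e' = e := by
  have := hS.mono_f
  obtain ⟨t, f, hf, rfl⟩ := cls_surj e
  rw [cls_map _ _ _ (by rw [reassoc_of% hf, zero_comp])] at he
  obtain ⟨s, hs, j, g, hg⟩ := cls_zero _ _ he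
  obtain ⟨g', rfl⟩ := ex_lift hS g
  obtain ⟨k, hk⟩ := ex_fac hS ((ph a hs).f n ≫ f - (Ct a s).d n j ≫ g') (by
    simp only [Preadditive.sub_comp, Category.assoc, hg, sub_self])
  have hk0 : (Ct a s).d (n+1) n ≫ k ≫ S.f = 0 := by
    rw [hk, Preadditive.comp_sub, ph_coc hs f hf, HomologicalComplex.d_comp_d_assoc, zero_comp,
      sub_zero]
  have hk1 : (Ct a s).d (n+1) n ≫ k = 0 := by
    rw [← cancel_mono S.f, Category.assoc, hk0, zero_comp]
  refine ⟨cls a k hk1, ?_⟩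
  rw [cls_map _ _ _ hk0]
  have hd : (Ct a s).d (n+1) n ≫ (Ct a s).d n j ≫ g' = 0 := by
    rw [HomologicalComplex.d_comp_d_assoc, zero_comp]
  have h3 : cls a (k ≫ S.f) hk0 = cls a ((ph a hs).f n ≫ f - (Ct a s).d n j ≫ g') (by rw [← hk, hk0]) := by
    congr 1
  rw [h3, cls_sub _ _ (ph_coc hs f hf) hd, cls_tr hs f hf, cls_zero_of _ hd j g' rfl, sub_zero]

lemma les1 (h : ∀ c, ∃ b, (localCohomology a n).map S.g b = c) (e : Ht a (n+1) S.X₁)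
    (he : (localCohomology a (n+1)).map S.f e = 0) : e = 0 := by
  have := hS.mono_f
  obtain ⟨t₀, f₀, hf₀, rfl⟩ := cls_surj e
  rw [cls_map _ _ _ (by rw [reassoc_of% hf₀, zero_comp])] at he
  obtain ⟨s, hs, j, g₀, hg₀⟩ := cls_zero _ _ he
  have hf := ph_coc hs f₀ hf₀
  rw [← cls_tr hs f₀ hf₀ hf]
  have : ∃ g : (Ct a s).X n ⟶ S.X₂, ((ph a hs).f (n+1) ≫ f₀) ≫ S.f = (Ct a s).d (n+1) n ≫ g := by
    by_cases hj : j = n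
    · subst hj; exact ⟨g₀, by simpa using hg₀⟩
    · refine ⟨0, ?_⟩
      rw [(Ct a s).shape (n+1) j (by simpa using fun h => hj h)] at hg₀
      simpa using hg₀
  generalize (ph a hs).f (n+1) ≫ f₀ = f at *
  obtain ⟨g, hg⟩ := this
  have hg1 : (Ct a s).d (n+1) n ≫ g ≫ S.g = 0 := by
    rw [← reassoc_of% hg, S.zero, comp_zero]
  obtain ⟨b, hb⟩ := h (cls a (g ≫ S.g) hg1)
  obtain ⟨u, b, hb', rfl⟩ := cls_surj b
  have hb1 : (Ct a u).d (n+1) n ≫ b ≫ S.g = 0 := by rw [reassoc_of% hb', zero_comp]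
  rw [cls_map _ _ _ hb1] at hb
  -- common stage
  have hsv : s ≤ max s u := le_max_left _ _
  have huv : u ≤ max s u := le_max_right _ _
  generalize max s u = v at *
  rw [← cls_tr hsv _ hg1 (ph_coc hsv _ hg1), ← cls_tr huv _ hb1 (ph_coc huv _ hb1), eq_comm,
    ← sub_eq_zero, ← cls_sub _ _ _ _ (by
      rw [Preadditive.comp_sub, ph_coc hsv _ hg1, ph_coc huv _ hb1, sub_zero])] at hb
  obtain ⟨w, hw, j, q, hq⟩ := cls_zero _ _ hb
  obtain ⟨q, rfl⟩ := ex_lift hS q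
  obtain ⟨k, hk⟩ := ex_fac hS ((ph a hw).f n ≫ ((ph a hsv).f n ≫ g - (ph a huv).f n ≫ b) -
      (Ct a w).d n j ≫ q) (by
    simpa [Preadditive.sub_comp, Preadditive.comp_sub, sub_eq_zero] using hq)
  have hfin : (ph a hw).f (n+1) ≫ (ph a hsv).f (n+1) ≫ f = (Ct a w).d (n+1) n ≫ k := by
    rw [← cancel_mono S.f]
    simp only [Category.assoc, hk, hg, Preadditive.comp_sub, HomologicalComplex.Hom.comm_assoc,
      HomologicalComplex.d_comp_d_assoc, zero_comp, sub_zero]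
    rw [← HomologicalComplex.Hom.comm_assoc, ← HomologicalComplex.Hom.comm_assoc,
      ← HomologicalComplex.Hom.comm_assoc (ph a hw), ← HomologicalComplex.Hom.comm_assoc (ph a huv), hb',
      comp_zero, comp_zero, sub_zero]
  have hc1 := ph_coc hsv f hf
  have hc2 := ph_coc hw _ hc1
  rw [← cls_tr hsv f hf hc1, ← cls_tr hw _ hc1 hc2, cls_zero_of _ hc2 n k hfin]

lemma les3 (h : Subsingleton (Ht a (n+1) S.X₁)) (c : Ht a n S.X₃) :
    ∃ b, (localCohomology a n).map S.g b = c := by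
  have := hS.mono_f
  obtain ⟨t, f, hf, rfl⟩ := cls_surj c
  obtain ⟨f, rfl⟩ := ex_lift hS f
  obtain ⟨k, hk⟩ := ex_fac hS ((Ct a t).d (n+1) n ≫ f) (by rw [Category.assoc, hf])
  have hk0 : (Ct a t).d (n+2) (n+1) ≫ k = 0 := by
    rw [← cancel_mono S.f, Category.assoc, hk, HomologicalComplex.d_comp_d_assoc, zero_comp, zero_comp]
  obtain ⟨s, hs, j, g₀, hg₀⟩ := cls_zero k hk0 (Subsingleton.elim _ _)
  have : ∃ g : (Ct a s).X n ⟶ S.X₁, ((ph a hs).f (n+1) ≫ k) = (Ct a s).d (n+1) n ≫ g := by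
    by_cases hj : j = n
    · subst hj; exact ⟨g₀, by simpa using hg₀⟩
    · refine ⟨0, ?_⟩
      rw [(Ct a s).shape (n+1) j (by simpa using fun h => hj h)] at hg₀
      simpa using hg₀
  obtain ⟨g, hg⟩ := this
  have hb : (Ct a s).d (n+1) n ≫ ((ph a hs).f n ≫ f - g ≫ S.f) = 0 := by
    rw [Preadditive.comp_sub, ← HomologicalComplex.Hom.comm_assoc, ← hk, ← reassoc_of% hg, sub_self]
  refine ⟨cls a _ hb, ?_⟩
  have he : ((ph a hs).f n ≫ f - g ≫ S.f) ≫ S.g = (ph a hs).f n ≫ f ≫ S.g := by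
    simp [Preadditive.sub_comp]
  have hb2 : (Ct a s).d (n+1) n ≫ ((ph a hs).f n ≫ f - g ≫ S.f) ≫ S.g = 0 := by
    rw [reassoc_of% hb, zero_comp]
  rw [cls_map _ _ _ hb2, ← cls_tr hs _ hf (ph_coc hs _ hf)]
  congr 1

end LES

section basic
variable {a} {n : ℕ} {Y : ModuleCat.{u} R}

lemma map_smul_id (r : R) (e : Ht a n Y) : (localCohomology a n).map (r • 𝟙 Y) e = r • e := by
  obtain ⟨t, f, hf, rfl⟩ := cls_surj e
  have h : (Ct a t).d (n+1) n ≫ f ≫ (r • 𝟙 Y) = 0 := by rw [reassoc_of% hf, zero_comp]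
  rw [cls_map _ _ _ h, ← cls_smul r f hf (by rw [Linear.comp_smul, hf, smul_zero])]
  congr 1

lemma tors (e : Ht a n Y) : ∃ k : ℕ, ∀ r ∈ a ^ k, r • e = 0 := by
  obtain ⟨t, f, hf, rfl⟩ := cls_surj e
  refine ⟨t, fun r hr => ?_⟩
  have hrf : (Ct a t).d (n+1) n ≫ (r • f) = 0 := by rw [Linear.comp_smul, hf, smul_zero]
  rw [← cls_smul r f hf hrf]
  have hX : r • 𝟙 (Xt a t) = 0 := by
    ext x
    obtain ⟨x, rfl⟩ := Ideal.Quotient.mk_surjective x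
    exact Ideal.Quotient.eq_zero_iff_mem.2 (Ideal.mul_mem_right _ _ hr)
  have hP : (r • 𝟙 (Ct a t)) ≫ (Pt a t).π = 0 := by
    have : (r • 𝟙 (Ct a t)) ≫ (Pt a t).π = (Pt a t).π ≫ (ChainComplex.single₀ _).map (r • 𝟙 (Xt a t)) := by
      apply HomologicalComplex.to_single_hom_ext
      simp only [HomologicalComplex.comp_f, HomologicalComplex.smul_f_apply,
        Linear.smul_comp, Category.id_comp]
      exact ((Linear.comp_smul _ _ _ ((Pt a t).π.f 0) r (𝟙 (Xt a t))).trans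
        (congrArg (r • ·) (Category.comp_id ((Pt a t).π.f 0)))).symm
    rw [this, hX, Functor.map_zero, comp_zero]
  have hh := (ProjectiveResolution.liftHomotopyZero (r • 𝟙 (Ct a t)) hP).comm n
  let H := (ProjectiveResolution.liftHomotopyZero (r • 𝟙 (Ct a t)) hP).hom
  refine cls_zero_of _ hrf ((ComplexShape.down ℕ).next n) (H _ n ≫ f) ?_
  have h3 : prevD n H = H n (n+1) ≫ (Ct a t).d (n+1) n := prevD_eq H (by simp)
  have h4 : dNext n H = (Ct a t).d n _ ≫ H ((ComplexShape.down ℕ).next n) n := rfl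
  have h5 : (r • 𝟙 (Ct a t)).f n = dNext n H + prevD n H + 0 := hh
  rw [h3, h4, add_zero] at h5
  have h6 := congrArg (· ≫ f) h5
  simpa [Preadditive.add_comp, hf] using h6

lemma inj_van (hI : Injective Y) : Subsingleton (Ht a (n+1) Y) := by
  refine ⟨fun x y => ?_⟩
  suffices ∀ x : Ht a (n+1) Y, x = 0 by rw [this x, this y]
  intro e
  obtain ⟨t, f, hf, rfl⟩ := cls_surj e
  have hex := (Pt a t).exact_succ n
  refine cls_zero_of _ hf n (hex.descToInjective f hf) ?_
  exact (hex.comp_descToInjective f hf).symm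

lemma zero_van (hY : Subsingleton Y) : Subsingleton (Ht a n Y) := by
  refine ⟨fun x y => ?_⟩
  suffices ∀ x : Ht a n Y, x = 0 by rw [this x, this y]
  intro e
  obtain ⟨t, f, hf, rfl⟩ := cls_surj e
  refine cls_zero_of _ hf n 0 ?_
  ext x
  exact Subsingleton.elim _ _

end basic


/-- Torsion modules. -/
def IsTor (Y : Type u) [AddCommGroup Y] [Module R Y] : Prop :=
  ∀ y : Y, ∃ k : ℕ, ∀ r ∈ a ^ k, r • y = 0

/-- The torsion submodule. -/
def Gam (E : Type u) [AddCommGroup E] [Module R E] : Submodule R E where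
  carrier := { y | ∃ k : ℕ, ∀ r ∈ a ^ k, r • y = 0 }
  zero_mem' := ⟨0, fun r _ => smul_zero r⟩
  add_mem' := by
    rintro x y ⟨k, hk⟩ ⟨l, hl⟩
    refine ⟨max k l, fun r hr => ?_⟩
    rw [smul_add, hk r (Ideal.pow_le_pow_right (le_max_left _ _) hr),
      hl r (Ideal.pow_le_pow_right (le_max_right _ _) hr), add_zero]
  smul_mem' := by
    rintro c x ⟨k, hk⟩
    refine ⟨k, fun r hr => ?_⟩
    rw [smul_comm, hk r hr, smul_zero]

lemma Gam_tor (E : Type u) [AddCommGroup E] [Module R E] : IsTor a (Gam a E) := by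
  rintro ⟨y, k, hk⟩
  exact ⟨k, fun r hr => Subtype.ext (hk r hr)⟩

lemma fin_tor {J Y : Type u} [AddCommGroup J] [Module R J] [Module.Finite R J]
    [AddCommGroup Y] [Module R Y] (hY : IsTor a Y) (g : J →ₗ[R] Y) :
    ∃ k : ℕ, ∀ r ∈ a ^ k, ∀ y, r • g y = 0 := by
  obtain ⟨s, hs⟩ := Module.Finite.fg_top (R := R) (M := J)
  choose k hk using fun y => hY (g y)
  refine ⟨s.sup k, fun r hr y => ?_⟩
  have hy : y ∈ Submodule.span R (s : Set J) := hs ▸ Submodule.mem_top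
  induction hy using Submodule.span_induction with
  | mem x hx => exact hk x r (Ideal.pow_le_pow_right (Finset.le_sup hx) hr)
  | zero => simp
  | add x y _ _ h1 h2 => rw [map_add, smul_add, h1, h2, add_zero]
  | smul c x _ h => rw [map_smul, smul_comm, h, smul_zero]

lemma Gam_inj [IsNoetherianRing R] (E : Type u) [AddCommGroup E] [Module R E]
    (hE : Module.Injective R E) : Module.Injective R (Gam a E) := by
  apply Module.Baer.injective
  intro J g
  obtain ⟨k, hk⟩ := fin_tor a (Gam_tor a E) g
  obtain ⟨m, hm⟩ := Ideal.exists_pow_inf_eq_pow_smul a (M := R) J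
  have hm := hm (k + m) (by omega)
  rw [Nat.add_sub_cancel, smul_eq_mul, Ideal.mul_top] at hm
  have hle : a ^ (k+m) ⊓ J ≤ a ^ k • J :=
    hm.le.trans (Submodule.smul_mono le_rfl inf_le_right)
  let U : J →ₗ[R] R ⧸ a ^ (k+m) := (Submodule.mkQ (a ^ (k+m))) ∘ₗ (Submodule.subtype J)
  have hker : LinearMap.ker U ≤ LinearMap.ker ((Gam a E).subtype ∘ₗ g) := by
    rintro ⟨y, hyJ⟩ hy
    have hy : y ∈ a ^ (k+m) := (Submodule.Quotient.mk_eq_zero _).1 hy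
    have hy2 : y ∈ a ^ k • J := hle ⟨hy, hyJ⟩
    have : ∀ z ∈ a ^ k • J, ∃ hz : z ∈ J, g ⟨z, hz⟩ = 0 := by
      intro z hz
      refine Submodule.smul_induction_on hz ?_ ?_
      · intro r hr y hy
        exact ⟨J.smul_mem r hy, (map_smul g r ⟨y, hy⟩).trans (hk r hr _)⟩
      · rintro x y ⟨hx, hx'⟩ ⟨hy, hy'⟩
        exact ⟨J.add_mem hx hy, (map_add g ⟨x, hx⟩ ⟨y, hy⟩).trans (by rw [hx', hy', add_zero])⟩
    simp [(this y hy2).2]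
  obtain ⟨h, hh⟩ := hE.out ((LinearMap.ker U).liftQ U le_rfl)
    (by rw [← LinearMap.ker_eq_bot]; exact Submodule.ker_liftQ_eq_bot _ _ _ le_rfl)
    ((LinearMap.ker U).liftQ ((Gam a E).subtype ∘ₗ g) hker)
  refine ⟨LinearMap.codRestrict _ (h ∘ₗ Submodule.mkQ (a ^ (k+m))) ?_, ?_⟩
  · intro c
    refine ⟨k + m, fun r hr => ?_⟩
    rw [← map_smul]
    have : r • c ∈ a ^ (k+m) := Ideal.mul_mem_right _ _ hr
    rw [LinearMap.comp_apply, Submodule.mkQ_apply, (Submodule.Quotient.mk_eq_zero _).2 this, map_zero]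
  · intro x hx
    apply Subtype.ext
    exact hh (Submodule.Quotient.mk ⟨x, hx⟩)

lemma exists_emb [IsNoetherianRing R] (Y : ModuleCat.{u} R) (hY : IsTor a Y) :
    ∃ (I : ModuleCat.{u} R) (i : Y ⟶ I), Mono i ∧ Injective I ∧ IsTor a I := by
  let E := Injective.under Y
  have hE : Module.Injective R E := Module.injective_module_of_injective_object R E (inj := inferInstanceAs (Injective E))
  have := Gam_inj a E hE
  have hI : Injective (ModuleCat.of R (Gam a E)) := Module.injective_object_of_injective_module R (Gam a E)
  refine ⟨ModuleCat.of R (Gam a E), ModuleCat.ofHom (LinearMap.codRestrict _ (Injective.ι Y).hom ?_), ?_, hI, Gam_tor a E⟩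
  · intro y
    obtain ⟨k, hk⟩ := hY y
    exact ⟨k, fun r hr => by rw [← map_smul, hk r hr, map_zero]⟩
  · rw [ModuleCat.mono_iff_injective]
    intro x y hxy
    have h : Mono (Injective.ι Y) := inferInstance
    exact (ModuleCat.mono_iff_injective _).1 h (congrArg Subtype.val hxy)

/-- augmentation -/
def pi0 (t : ℕ) : (Ct a t).X 0 ⟶ Xt a t := (Pt a t).π.f 0

lemma d_pi0 (t : ℕ) : (Ct a t).d 1 0 ≫ pi0 a t = 0 := (Pt a t).complex_d_comp_π_f_zero

lemma ph_pi0 {t s : ℕ} (h : t ≤ s) : (ph a h).f 0 ≫ pi0 a t = pi0 a s ≫ wt a h := ph_comm a h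

lemma h0_surj {S : ShortComplex (ModuleCat.{u} R)} (hS : S.ShortExact) (hT : IsTor a S.X₂)
    (c : Ht a 0 S.X₃) : ∃ b, (localCohomology a 0).map S.g b = c := by
  obtain ⟨t, f, hf, rfl⟩ := cls_surj c
  obtain ⟨f', hf'⟩ : ∃ f' : Xt a t ⟶ S.X₃, pi0 a t ≫ f' = f := by
    have := (Pt a t).isColimitCokernelCofork
    exact ⟨this.desc (CokernelCofork.ofπ f hf), this.fac (CokernelCofork.ofπ f hf) WalkingParallelPair.one⟩
  have hepi := hS.epi_g
  obtain ⟨c', hc'⟩ := (ModuleCat.epi_iff_surjective _).1 hepi (f' (Ideal.Quotient.mk _ 1))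
  obtain ⟨k, hk⟩ := hT c'
  have hs : t ≤ max t k := le_max_left _ _
  have hk' : ∀ r ∈ a ^ (max t k), r • c' = 0 := fun r hr =>
    hk r (Ideal.pow_le_pow_right (le_max_right _ _) hr)
  generalize max t k = s at *
  let g : Xt a s ⟶ S.X₂ := ModuleCat.ofHom (Submodule.liftQ (a ^ s) (LinearMap.toSpanSingleton R S.X₂ c')
    (fun r hr => hk' r hr))
  have hg : g ≫ S.g = wt a hs ≫ f' := by
    ext x
    obtain ⟨x, rfl⟩ := Submodule.Quotient.mk_surjective _ x
    have h1 : g (Submodule.Quotient.mk x) = x • c' := rfl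
    have h2 : wt a hs (Submodule.Quotient.mk x) = (x • (Ideal.Quotient.mk _ 1) : R ⧸ a ^ t) := by
      change Ideal.Quotient.mk (a ^ t) x = _
      rw [Algebra.smul_def, map_one, mul_one]
      rfl
    change S.g (g _) = f' (wt a hs _)
    rw [h1, h2, map_smul, hc']
    exact (map_smul f'.hom _ _).symm
  have hd : (Ct a s).d (0+1) 0 ≫ pi0 a s ≫ g = 0 := by
    rw [zero_add, ← Category.assoc, d_pi0, zero_comp]
  refine ⟨cls a (pi0 a s ≫ g) hd, ?_⟩
  have he : (pi0 a s ≫ g) ≫ S.g = (ph a hs).f 0 ≫ f := by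
    rw [← hf', Category.assoc, hg, ← Category.assoc, ← Category.assoc, ph_pi0]
  rw [cls_map _ _ _ (by rw [Category.assoc, ← Category.assoc, ← Category.assoc]; simp [d_pi0]), ← cls_tr hs _ hf (ph_coc hs _ hf)]
  congr 1

lemma tor_van [IsNoetherianRing R] (n : ℕ) : ∀ (Y : ModuleCat.{u} R) (hY : IsTor a Y),
    Subsingleton (Ht a (n+1) Y) := by
  induction n with
  | zero =>
    intro Y hY
    obtain ⟨I, i, hi, hI, hIt⟩ := exists_emb a Y hY
    have hS : (ShortComplex.mk i (cokernel.π i) (by simp)).ShortExact :=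
      { exact := ShortComplex.exact_cokernel i }
    have := inj_van (a := a) (n := 0) hI
    have h0 : ∀ e : Ht a (0+1) Y, e = 0 := fun e =>
      les1 hS (h0_surj a hS hIt) e (this.elim _ _)
    exact ⟨fun x y => by rw [h0 x, h0 y]⟩
  | succ n ih =>
    intro Y hY
    obtain ⟨I, i, hi, hI, hIt⟩ := exists_emb a Y hY
    have hS : (ShortComplex.mk i (cokernel.π i) (by simp)).ShortExact :=
      { exact := ShortComplex.exact_cokernel i }
    have := inj_van (a := a) (n := n + 1) hI
    have hct : IsTor a ((cokernel i : ModuleCat.{u} R)) := by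
      intro y
      have hepi : Epi (cokernel.π i) := inferInstance
      obtain ⟨y, rfl⟩ := (ModuleCat.epi_iff_surjective _).1 hepi y
      obtain ⟨k, hk⟩ := hIt y
      exact ⟨k, fun r hr => by rw [← map_smul, hk r hr, map_zero]⟩
    have h3 := ih _ hct
    have h0 : ∀ e : Ht a (n+1+1) Y, e = 0 := fun e =>
      les1 hS (fun c => ⟨0, h3.elim _ _⟩) e (this.elim _ _)
    exact ⟨fun x y => by rw [h0 x, h0 y]⟩


section CA
open Module

/-- short exact sequence of modules from linear maps -/
lemma mkSE {N₁ N₂ N₃ : Type u} [AddCommGroup N₁] [AddCommGroup N₂] [AddCommGroup N₃]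
    [Module R N₁] [Module R N₂] [Module R N₃] (f : N₁ →ₗ[R] N₂) (g : N₂ →ₗ[R] N₃)
    (hf : Function.Injective f) (hg : Function.Surjective g) (h : Function.Exact f g) :
    (ShortComplex.mk (ModuleCat.ofHom f) (ModuleCat.ofHom g) (by
      ext x; exact (h _).2 ⟨x, rfl⟩)).ShortExact := by
  refine { exact := ?_, mono_f := ?_, epi_g := ?_ }
  · rw [ShortComplex.moduleCat_exact_iff]
    intro x hx
    exact (h x).1 hx
  · exact (ModuleCat.mono_iff_injective _).2 hf
  · exact (ModuleCat.epi_iff_surjective _).2 hg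

lemma iso_van {n : ℕ} {Y Z : ModuleCat.{u} R} (e : Y ≅ Z) (h : Subsingleton (Ht a n Y)) :
    Subsingleton (Ht a n Z) :=
  ((localCohomology a n).mapIso e).toLinearEquiv.symm.toEquiv.subsingleton

variable [IsNoetherianRing R]

lemma filt (n : ℕ) (N : Type u) [AddCommGroup N] [Module R N] (hN : Module.Finite R N) :
    (∀ q ∈ Module.support R N, Subsingleton (Ht a n (ModuleCat.of R (R ⧸ q.asIdeal)))) →
    Subsingleton (Ht a n (ModuleCat.of R N)) := by
  induction hN using IsNoetherianRing.induction_on_isQuotientEquivQuotientPrime R with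
  | subsingleton N => intro _; exact zero_van (by assumption)
  | quotient N q e =>
    intro h
    refine iso_van a e.symm.toModuleIso (h q ?_)
    rw [e.support_eq, Module.mem_support_iff_of_finite, Ideal.annihilator_quotient]
  | exact N₁ N₂ N₃ f g hf hg hfg h₁ h₃ =>
    intro h
    have hs := Module.support_of_exact hfg hf hg
    have h1 := h₁ fun q hq => h q (by rw [hs]; exact Or.inl hq)
    have h3 := h₃ fun q hq => h q (by rw [hs]; exact Or.inr hq)
    have h0 : ∀ e : Ht a n (ModuleCat.of R N₂), e = 0 := fun e => by
      obtain ⟨e', rfl⟩ := les2 (mkSE f g hf hg hfg) e (h3.elim _ _)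
      rw [h1.elim e' 0, map_zero]
    exact ⟨fun x y => by rw [h0 x, h0 y]⟩

omit [IsNoetherianRing R] in
lemma drop {q I : Ideal R} [q.IsPrime] (hqI : q ≤ I) {x : R} (hx : x ∈ I) (hxq : x ∉ q) :
    ringKrullDim (R ⧸ I) + 1 ≤ ringKrullDim (R ⧸ q) := by
  refine ringKrullDim_succ_le_of_surjective (Ideal.Quotient.factor hqI)
    (Ideal.Quotient.factor_surjective hqI) (r := Ideal.Quotient.mk q x) ?_ ?_
  · rw [mem_nonZeroDivisors_iff_ne_zero, Ne, Ideal.Quotient.eq_zero_iff_mem]; exact hxq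
  · simpa [Ideal.Quotient.eq_zero_iff_mem] using hx

omit [IsNoetherianRing R] in
lemma dim_le {N : Type u} [AddCommGroup N] [Module R N] [Module.Finite R N]
    (q : PrimeSpectrum R) (hq : q ∈ Module.support R N) :
    ringKrullDim (R ⧸ q.asIdeal) ≤ Module.supportDim R N := by
  rw [Module.supportDim_eq_ringKrullDim_quotient_annihilator]
  rw [Module.mem_support_iff_of_finite] at hq
  exact ringKrullDim_le_of_surjective _ (Ideal.Quotient.factor_surjective hq)

lemma wb1 {d e : WithBot ℕ∞} {i : ℕ} (h : d + 1 ≤ e) (h' : e < (((i + 1 : ℕ) : ℕ∞) : WithBot ℕ∞)) :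
    d < ((i : ℕ∞) : WithBot ℕ∞) := by
  have h2 := h.trans_lt h'
  induction d with
  | bot => exact WithBot.bot_lt_coe _
  | coe d =>
    have h3 : d + 1 < ((i + 1 : ℕ) : ℕ∞) := by exact_mod_cast h2
    rw [WithBot.coe_lt_coe]
    rw [Nat.cast_add, Nat.cast_one] at h3
    exact lt_of_add_lt_add_right h3

lemma van (i : ℕ) : ∀ (N : Type u) [AddCommGroup N] [Module R N] (_ : Module.Finite R N),
    Module.supportDim R N < ((i : ℕ∞) : WithBot ℕ∞) →
    Subsingleton (Ht a i (ModuleCat.of R N)) := by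
  induction i with
  | zero =>
    intro N _ _ _ h
    refine zero_van ?_
    by_contra hn
    rw [not_subsingleton_iff_nontrivial, ← Module.supportDim_ne_bot_iff_nontrivial R] at hn
    obtain ⟨d, hd⟩ := WithBot.ne_bot_iff_exists.1 hn
    rw [← hd, WithBot.coe_lt_coe] at h
    exact absurd h (by simp)
  | succ i ih =>
    intro N _ _ hN h
    refine filt a _ N hN fun q hq => ?_
    have hd := (dim_le q hq).trans_lt h
    by_cases haq : a ≤ q.asIdeal
    · refine tor_van a i _ fun y => ⟨1, fun r hr => ?_⟩
      obtain ⟨y, rfl⟩ := Ideal.Quotient.mk_surjective (I := q.asIdeal) y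
      rw [pow_one] at hr
      refine Ideal.Quotient.eq_zero_iff_mem.2 ?_
      exact q.asIdeal.mul_mem_right _ (haq hr)
    · obtain ⟨x, hxa, hxq⟩ := SetLike.not_le_iff_exists.1 haq
      let I := q.asIdeal ⊔ Ideal.span {x}
      have hxI : x ∈ I := Ideal.mem_sup_right (Ideal.mem_span_singleton_self x)
      have hdr := wb1 (drop (le_sup_left : q.asIdeal ≤ I) hxI hxq) hd
      rw [← Module.supportDim_quotient_eq_ringKrullDim] at hdr
      have hI := ih (R ⧸ I) inferInstance hdr
      let f : (R ⧸ q.asIdeal) →ₗ[R] (R ⧸ q.asIdeal) := x • LinearMap.id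
      let g : (R ⧸ q.asIdeal) →ₗ[R] (R ⧸ I) := Submodule.factor (le_sup_left : q.asIdeal ≤ I)
      have hf : Function.Injective f := by
        rw [injective_iff_map_eq_zero]
        intro y hy
        obtain ⟨y, rfl⟩ := Ideal.Quotient.mk_surjective (I := q.asIdeal) y
        have hy : Ideal.Quotient.mk q.asIdeal (x * y) = 0 := hy
        rw [Ideal.Quotient.eq_zero_iff_mem] at hy ⊢
        exact (q.2.mem_or_mem hy).resolve_left hxq
      have hg : Function.Surjective g := Submodule.factor_surjective _
      have hfg : Function.Exact f g := by
        intro y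
        obtain ⟨y, rfl⟩ := Ideal.Quotient.mk_surjective (I := q.asIdeal) y
        have e1 : g (Ideal.Quotient.mk q.asIdeal y) = Ideal.Quotient.mk I y := rfl
        rw [e1, Ideal.Quotient.eq_zero_iff_mem]
        constructor
        · intro hy
          obtain ⟨z, hz, w, hw, rfl⟩ := Submodule.mem_sup.1 hy
          obtain ⟨c, rfl⟩ := Ideal.mem_span_singleton.1 hw
          refine ⟨Ideal.Quotient.mk _ c, ?_⟩
          rw [map_add, Ideal.Quotient.eq_zero_iff_mem.2 hz, zero_add]
          rfl
        · rintro ⟨z, hz⟩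
          obtain ⟨z, rfl⟩ := Ideal.Quotient.mk_surjective (I := q.asIdeal) z
          have hz : Ideal.Quotient.mk q.asIdeal (x * z) = Ideal.Quotient.mk q.asIdeal y := hz
          rw [Ideal.Quotient.eq] at hz
          have h1 : x * z ∈ I := I.mul_mem_right _ hxI
          have h2 : x * z - y ∈ I := Ideal.mem_sup_left hz
          simpa using I.sub_mem h1 h2
      have key : ∀ e : Ht a (i+1) (ModuleCat.of R (R ⧸ q.asIdeal)), x • e = 0 → e = 0 := by
        intro e he
        refine les1 (mkSE f g hf hg hfg) (fun c => ⟨0, hI.elim _ _⟩) e ?_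
        rw [← map_smul_id] at he
        exact he
      have key2 : ∀ k, ∀ e : Ht a (i+1) (ModuleCat.of R (R ⧸ q.asIdeal)), x ^ k • e = 0 → e = 0 := by
        intro k
        induction k with
        | zero => intro e he; simpa using he
        | succ k ihk => intro e he; rw [pow_succ, mul_smul] at he; exact key e (ihk _ he)
      have h0 : ∀ e : Ht a (i+1) (ModuleCat.of R (R ⧸ q.asIdeal)), e = 0 := fun e => by
        obtain ⟨k, hk⟩ := tors e
        exact key2 k e (hk _ (Ideal.pow_mem_pow hxa k))
      exact ⟨fun x y => by rw [h0 x, h0 y]⟩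

lemma ass_sub {M : Type u} [AddCommGroup M] [Module R M] [Module.Finite R M] (T : Set (Ideal R))
    (hT : T ⊆ associatedPrimes R M) : ∃ N : Submodule R M, associatedPrimes R (M ⧸ N) = T ∧
      associatedPrimes R N ⊆ associatedPrimes R M \ T := by
  let F0 : Set (Submodule R M) := {N | associatedPrimes R N ⊆ associatedPrimes R M \ T}
  have hne : F0.Nonempty := ⟨⊥, by
    change associatedPrimes R (⊥ : Submodule R M) ⊆ _
    rw [associatedPrimes.eq_empty_of_subsingleton]; exact Set.empty_subset _⟩
  obtain ⟨N, hN, hmax⟩ := set_has_maximal_iff_noetherian.2 (inferInstance : IsNoetherian R M) F0 hne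
  have hN : associatedPrimes R N ⊆ associatedPrimes R M \ T := hN
  refine ⟨N, Set.Subset.antisymm ?_ ?_, hN⟩
  · intro p hp
    obtain ⟨hpp, f, hf⟩ := (isAssociatedPrime_iff_exists_injective_linearMap _ _).1 hp
    by_contra hpT
    let N' : Submodule R M := (LinearMap.range f).comap N.mkQ
    have hNN' : N ≤ N' := by
      intro x hx
      have : N.mkQ x = 0 := by simpa using hx
      change N.mkQ x ∈ LinearMap.range f
      rw [this]; exact Submodule.zero_mem _
    have hlt : N < N' := by
      refine lt_of_le_of_ne hNN' fun heq => ?_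
      obtain ⟨x, hx⟩ := N.mkQ_surjective (f 1)
      have hx' : x ∈ N' := ⟨1, hx.symm⟩
      rw [← heq] at hx'
      have : f 1 = 0 := by rw [← hx]; simpa using hx'
      have h1 : (1 : R ⧸ p) = 0 := hf (by rw [this, map_zero])
      have := Ideal.Quotient.nontrivial_iff.2 hpp.ne_top
      exact one_ne_zero h1
    let g : N' →ₗ[R] LinearMap.range f := (N.mkQ.comp N'.subtype).codRestrict _ fun x => x.2
    have hex : Function.Exact (Submodule.inclusion hNN') g := by
      intro y
      rw [Subtype.ext_iff]
      change N.mkQ y.1 = 0 ↔ _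
      rw [Submodule.mkQ_apply, Submodule.Quotient.mk_eq_zero]
      constructor
      · intro h; exact ⟨⟨y.1, h⟩, rfl⟩
      · rintro ⟨z, rfl⟩; exact z.2
    have hsub := associatedPrimes.subset_union_of_exact (Submodule.inclusion_injective hNN') hex
    rw [← LinearEquiv.AssociatedPrimes.eq (LinearEquiv.ofInjective f hf),
      associatedPrimes.eq_singleton_of_isPrimary hpp.isPrimary, hpp.radical] at hsub
    refine hmax N' ?_ hlt
    intro r hr
    refine ⟨associatedPrimes.subset_of_injective N'.injective_subtype hr, ?_⟩
    rcases hsub hr with h | h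
    · exact (hN h).2
    · rw [Set.mem_singleton_iff.1 h]; exact hpT
  · intro p hp
    have hsub := associatedPrimes.subset_union_of_exact (N.injective_subtype)
      (LinearMap.exact_subtype_mkQ N)
    exact (hsub (hT hp)).resolve_left fun h => (hN h).2 hp

lemma ass_supp {M : Type u} [AddCommGroup M] [Module R M] [Module.Finite R M] {p : Ideal R}
    (hp : p ∈ associatedPrimes R M) : ringKrullDim (R ⧸ p) ≤ Module.supportDim R M := by
  obtain ⟨_, f, hf⟩ := (isAssociatedPrime_iff_exists_injective_linearMap _ _).1 hp
  rw [← Module.supportDim_quotient_eq_ringKrullDim]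
  exact Module.supportDim_le_of_injective f hf

end CA

lemma cd_iff {R : Type u} [CommRing R] [IsNoetherianRing R] (a : Ideal R) (p : Ideal R) (n : ℕ)
    (h : ringKrullDim (R ⧸ p) ≤ ((n : ℕ∞) : WithBot ℕ∞)) :
    cohDim R a (R ⧸ p) = ((n : ℕ∞) : WithBot ℕ∞) ↔ Nontrivial (LC a n (R ⧸ p)) := by
  have hv : ∀ i : ℕ, Nontrivial (LC a i (R ⧸ p)) → i ≤ n := by
    intro i hi
    by_contra hlt
    rw [← not_subsingleton_iff_nontrivial] at hi
    refine hi (van a i (R ⧸ p) inferInstance ?_)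
    rw [Module.supportDim_quotient_eq_ringKrullDim]
    refine h.trans_lt ?_
    rw [WithBot.coe_lt_coe]
    exact_mod_cast not_le.1 hlt
  constructor
  · intro hc
    by_contra hn
    have hv' : ∀ i : ℕ, Nontrivial (LC a i (R ⧸ p)) → i < n := fun i hi =>
      lt_of_le_of_ne (hv i hi) (by rintro rfl; exact hn hi)
    cases n with
    | zero =>
      have : cohDim R a (R ⧸ p) ≤ ⊥ := by
        refine sSup_le ?_
        rintro x ⟨i, rfl, hi⟩
        exact absurd (hv' i hi) (by simp)
      rw [hc] at this
      exact absurd this (by rw [le_bot_iff]; exact WithBot.coe_ne_bot)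
    | succ k =>
      have : cohDim R a (R ⧸ p) ≤ ((k : ℕ∞) : WithBot ℕ∞) := by
        refine sSup_le ?_
        rintro x ⟨i, rfl, hi⟩
        rw [WithBot.coe_le_coe]
        exact_mod_cast Nat.lt_succ_iff.1 (hv' i hi)
      rw [hc, WithBot.coe_le_coe] at this
      have h2 : k + 1 ≤ k := by exact_mod_cast this
      omega
  · intro hn
    refine le_antisymm (sSup_le ?_) (le_sSup ⟨n, rfl, hn⟩)
    rintro x ⟨i, rfl, hi⟩
    rw [WithBot.coe_le_coe]
    exact_mod_cast hv i hi

end LCaux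

open LCaux
theorem stmt2 (R : Type u) [CommRing R] [IsNoetherianRing R] [IsLocalRing R]
    (a : Ideal R) (ha : a ≠ ⊤) (M : Type u) [AddCommGroup M] [Module R M]
    [Module.Finite R M] (n : ℕ) (hdim : mdim R M = (n : ℕ∞))
    (hne : Nontrivial (LC a n M)) :
    ∃ N : Submodule R M,
      mdim R (M ⧸ N) = (n : ℕ∞) ∧
      (∀ L : Submodule R (M ⧸ N), L ≠ ⊥ → ¬ mdim R L < (n : ℕ∞)) ∧
      associatedPrimes R (M ⧸ N) =
        { p | p ∈ associatedPrimes R M ∧ cohDim R a (R ⧸ p) = (n : ℕ∞) } ∧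
      Nonempty ((LC a n (M ⧸ N)) ≅ (LC a n M)) := by
  classical
  have hM : Module.supportDim R M = ((n : ℕ∞) : WithBot ℕ∞) := hdim
  obtain ⟨N, hAss, hAssN⟩ := ass_sub (R := R) (M := M)
    { p | p ∈ associatedPrimes R M ∧ cohDim R a (R ⧸ p) = (n : ℕ∞) } (fun p hp => hp.1)
  have hN : Module.supportDim R N ≤ ((n : ℕ∞) : WithBot ℕ∞) :=
    (Module.supportDim_le_of_injective N.subtype N.injective_subtype).trans hM.le
  -- primes in the set have dimension n
  have hTd : ∀ p ∈ associatedPrimes R (M ⧸ N),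
      ((n : ℕ∞) : WithBot ℕ∞) ≤ ringKrullDim (R ⧸ p) := by
    intro p hp
    rw [hAss] at hp
    have h1 := (cd_iff a p n ((ass_supp hp.1).trans hM.le)).1 hp.2
    by_contra hlt
    rw [← not_subsingleton_iff_nontrivial] at h1
    refine h1 (van a n (R ⧸ p) inferInstance ?_)
    rw [Module.supportDim_quotient_eq_ringKrullDim]
    exact not_le.1 hlt
  -- vanishing for N
  have hNv : Subsingleton (LC a n N) := by
    refine filt a n N inferInstance fun q hq => ?_
    have hqd := (dim_le q hq).trans hN
    by_cases hlt : ringKrullDim (R ⧸ q.asIdeal) < ((n : ℕ∞) : WithBot ℕ∞)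
    · refine van a n (R ⧸ q.asIdeal) inferInstance ?_
      rw [Module.supportDim_quotient_eq_ringKrullDim]
      exact hlt
    · have hq1 := Module.mem_support_iff_of_finite.1 hq
      have hmin : q.asIdeal ∈ (Module.annihilator R N).minimalPrimes := by
        refine ⟨⟨q.2, hq1⟩, ?_⟩
        rintro r ⟨hr, hr1⟩ hrq
        intro x hx
        by_contra hxr
        have h1 := drop hrq hx hxr
        have h2 : ringKrullDim (R ⧸ r) ≤ ((n : ℕ∞) : WithBot ℕ∞) :=
          (dim_le ⟨r, hr⟩ (Module.mem_support_iff_of_finite.2 hr1)).trans hN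
        refine hlt (wb1 h1 (h2.trans_lt ?_))
        rw [WithBot.coe_lt_coe]
        exact_mod_cast Nat.lt_succ_self n
      have hass := hAssN (Module.associatedPrimes.minimalPrimes_annihilator_subset_associatedPrimes
        R N hmin)
      by_contra hns
      rw [not_subsingleton_iff_nontrivial] at hns
      exact hass.2 ⟨hass.1, (cd_iff a q.asIdeal n hqd).2 hns⟩
  have hNv1 : Subsingleton (LC a (n + 1) N) := by
    refine van a (n + 1) N inferInstance (hN.trans_lt ?_)
    rw [WithBot.coe_lt_coe]
    exact_mod_cast Nat.lt_succ_self n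
  have hS := mkSE N.subtype N.mkQ N.injective_subtype N.mkQ_surjective
    (LinearMap.exact_subtype_mkQ N)
  let φ : LC a n M ⟶ LC a n (M ⧸ N) := (localCohomology a n).map (ModuleCat.ofHom N.mkQ)
  have hinj : Function.Injective φ := by
    rw [injective_iff_map_eq_zero]
    intro e he
    obtain ⟨e', rfl⟩ := les2 hS e he
    rw [hNv.elim e' 0, map_zero]
  have hsurj : Function.Surjective φ := fun c => les3 hS hNv1 c
  have hnt : Nontrivial (M ⧸ N) := by
    rw [← not_subsingleton_iff_nontrivial]
    intro hs
    have h1 : Subsingleton (LC a n (M ⧸ N)) := zero_van hs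
    exact not_subsingleton_iff_nontrivial.2 hne hinj.subsingleton
  refine ⟨N, ?_, ?_, hAss, ⟨(LinearEquiv.ofBijective φ.hom ⟨hinj, hsurj⟩).toModuleIso.symm⟩⟩
  · refine le_antisymm ?_ ?_
    · exact (Module.supportDim_le_of_surjective N.mkQ N.mkQ_surjective).trans hM.le
    · obtain ⟨p, hp⟩ := associatedPrimes.nonempty R (M ⧸ N)
      exact (hTd p hp).trans (ass_supp hp)
  · intro L hL
    have : Nontrivial L := Submodule.nontrivial_iff_ne_bot.2 hL
    obtain ⟨p, hp⟩ := associatedPrimes.nonempty R L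
    have hp' := associatedPrimes.subset_of_injective L.injective_subtype hp
    exact not_lt.2 ((hTd p hp').trans (ass_supp hp))

end
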